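/- Fix α ∈ (0, 1/2), μ > 0, and Ψ ≥ 0. The map σ ↦ H(σ, μ, Ψ) is differentiable at every σ > 0 with derivative ∂H(σ, μ, Ψ)/∂σ = −( φ((Ψ + μ)/σ + G(μ/σ))·((G′(μ/σ) + 1)μ + Ψ) + φ(Ψ/σ − G(μ/σ))·(G′(μ/σ)μ − Ψ) ) / σ², where G′ denotes the derivative of G. -/

import Mathlib

open MeasureTheory ProbabilityTheory

/-- The standard normal cumulative distribution function. -/
noncomputable def Phi (x : ℝ) : ℝ := (gaussianReal 0 1 (Set.Iic x)).toReal

/-- The standard normal density. -/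
noncomputable def phi (x : ℝ) : ℝ := Real.exp (-(x ^ 2) / 2) / Real.sqrt (2 * Real.pi)

/-- `H(σ, μ, Ψ) = Φ((Ψ + μ)/σ + G(μ/σ)) − Φ(Ψ/σ − G(μ/σ))`, for a given `G`. -/
noncomputable def Hfun (G : ℝ → ℝ) (σ μ Ψ : ℝ) : ℝ :=
  Phi ((Ψ + μ) / σ + G (μ / σ)) - Phi (Ψ / σ - G (μ / σ))

lemma phi_pos (x : ℝ) : 0 < phi x := by
  unfold phi; positivity

lemma gaussianPDFReal_zero_one (x : ℝ) : gaussianPDFReal 0 1 x = phi x := by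
  simp [gaussianPDFReal_def, phi, div_eq_inv_mul]

lemma continuous_phi : Continuous phi := by
  unfold phi; fun_prop

lemma integrable_phi : Integrable phi := by
  simpa only [funext gaussianPDFReal_zero_one] using integrable_gaussianPDFReal 0 1

lemma Phi_eq_integral (x : ℝ) : Phi x = ∫ t in Set.Iic x, phi t := by
  rw [Phi, gaussianReal_apply_eq_integral 0 one_ne_zero, funext gaussianPDFReal_zero_one,
    ENNReal.toReal_ofReal (integral_nonneg fun t => (phi_pos t).le)]

lemma Phi_eq_add_intervalIntegral (x : ℝ) : Phi x = Phi 0 + ∫ t in (0 : ℝ)..x, phi t := by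
  rw [← intervalIntegral.integral_Iic_sub_Iic integrable_phi.integrableOn
    integrable_phi.integrableOn, ← Phi_eq_integral, ← Phi_eq_integral]
  ring

lemma hasStrictDerivAt_Phi (x : ℝ) : HasStrictDerivAt Phi (phi x) x := by
  rw [funext Phi_eq_add_intervalIntegral]
  exact (intervalIntegral.integral_hasStrictDerivAt_right
    (continuous_phi.intervalIntegrable _ _)
    (continuous_phi.stronglyMeasurableAtFilter _ _) continuous_phi.continuousAt).const_add _

lemma strictMono_Phi : StrictMono Phi :=
  strictMono_of_hasDerivAt_pos (fun x => (hasStrictDerivAt_Phi x).hasDerivAt) phi_pos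

/-- The coverage probability `Φ(c + y) − Φ(−c)` is strictly increasing in `c`. -/
lemma strictMono_Phi_add_sub_Phi_neg (y : ℝ) : StrictMono fun c => Phi (c + y) - Phi (-c) :=
  fun _ _ h => sub_lt_sub (strictMono_Phi (by linarith)) (strictMono_Phi (by linarith))

/-- A function solving `Φ(G y + y) − Φ(−G y) = k` near `y` is differentiable at `y`. -/
lemma differentiableAt_of_eventually_Phi_eq {G : ℝ → ℝ} {k y : ℝ}
    (hG : ∀ᶠ z in nhds y, Phi (G z + z) - Phi (-(G z)) = k) : DifferentiableAt ℝ G y := by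
  let f : ℝ × ℝ → ℝ := fun p => Phi (p.2 + p.1) - Phi (-p.2)
  let f' : ℝ × ℝ →L[ℝ] ℝ :=
    phi (G y + y) • (.snd ℝ ℝ ℝ + .fst ℝ ℝ ℝ) - phi (-(G y)) • (-.snd ℝ ℝ ℝ)
  have hf : HasStrictFDerivAt f f' (y, G y) := by
    have hadd : HasStrictFDerivAt (fun p : ℝ × ℝ => p.2 + p.1)
        (.snd ℝ ℝ ℝ + .fst ℝ ℝ ℝ) (y, G y) :=
      hasStrictFDerivAt_snd.add hasStrictFDerivAt_fst
    have hneg : HasStrictFDerivAt (fun p : ℝ × ℝ => -p.2) (-.snd ℝ ℝ ℝ) (y, G y) :=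
      hasStrictFDerivAt_snd.neg
    have hΦadd := (hasStrictDerivAt_Phi (G y + y)).comp_hasStrictFDerivAt (y, G y) hadd
    have hΦneg := (hasStrictDerivAt_Phi (-(G y))).comp_hasStrictFDerivAt (y, G y) hneg
    exact hΦadd.sub hΦneg
  have hinv : (f' ∘L .inr ℝ ℝ ℝ).IsInvertible := by
    have hd : phi (G y + y) + phi (-(G y)) ≠ 0 :=
      (add_pos (phi_pos _) (phi_pos _)).ne'
    refine ⟨ContinuousLinearEquiv.unitsEquivAut ℝ (Units.mk0 _ hd), ?_⟩
    ext
    simp [f']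
  refine (hf.hasStrictFDerivAt_implicitFunctionOfProdDomain
    hinv).hasFDerivAt.differentiableAt.congr_of_eventuallyEq ?_
  filter_upwards [hG, hf.eventually_apply_implicitFunctionOfProdDomain hinv] with z hz hψ
  exact (strictMono_Phi_add_sub_Phi_neg z).injective (hz.trans (hG.self_of_nhds.symm.trans hψ.symm))

/-- For fixed `α ∈ (0, 1/2)`, `μ > 0` and `Ψ ≥ 0`, with `G` the function
assigning to each `y ≥ 0` the unique `c > 0` with `Φ(c + y) − Φ(−c) = 1 − α`, the map
`σ ↦ H(σ, μ, Ψ)` is differentiable at every `σ > 0` with derivative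
`−(φ((Ψ+μ)/σ + G(μ/σ))·((G′(μ/σ)+1)μ + Ψ) + φ(Ψ/σ − G(μ/σ))·(G′(μ/σ)μ − Ψ))/σ²`. -/
theorem H_hasDerivAt_in_sigma
    (α : ℝ) (hα : 0 < α) (hα' : α < 1 / 2)
    (G : ℝ → ℝ)
    (hG : ∀ y : ℝ, 0 ≤ y → 0 < G y ∧ Phi (G y + y) - Phi (-(G y)) = 1 - α)
    (μ Ψ : ℝ) (hμ : 0 < μ) (hΨ : 0 ≤ Ψ)
    (σ : ℝ) (hσ : 0 < σ) :
    HasDerivAt (fun s => Hfun G s μ Ψ)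
      (-(phi ((Ψ + μ) / σ + G (μ / σ)) * ((deriv G (μ / σ) + 1) * μ + Ψ) +
          phi (Ψ / σ - G (μ / σ)) * (deriv G (μ / σ) * μ - Ψ)) / σ ^ 2) σ := by
  have hy : 0 < μ / σ := div_pos hμ hσ
  have hGd : HasDerivAt G (deriv G (μ / σ)) (μ / σ) :=
    (differentiableAt_of_eventually_Phi_eq (k := 1 - α) <| by
      filter_upwards [lt_mem_nhds hy] with z hz using (hG z hz.le).2).hasDerivAt
  have hdiv (a : ℝ) : HasDerivAt (fun s : ℝ => a / s) (-a / σ ^ 2) σ := by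
    simpa [div_eq_mul_inv] using (hasDerivAt_inv hσ.ne').const_mul a
  have hGs := hGd.comp σ (hdiv μ)
  have hH := ((hasStrictDerivAt_Phi _).hasDerivAt.comp σ ((hdiv (Ψ + μ)).add hGs)).sub
    ((hasStrictDerivAt_Phi _).hasDerivAt.comp σ ((hdiv Ψ).sub hGs))
  refine hH.congr_deriv ?_
  simp only [Pi.add_apply, Pi.sub_apply, Function.comp_apply]
  ring
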